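/- arXiv:math/0110182 — 2 statements merged into one kernel-verified Lean document; each statement's English description precedes it below -/
import Mathlib

section
/- Let ν ∈ ℝ, ν ≠ 0, μ > 0 and H > 0. Then the improper integral ∫_0^∞ J_0(2μρ) ρ (H^{−2} + ρ²)^{−1−iν} dρ converges absolutely and Γ(1 + iν) ∫_0^∞ J_0(2μρ) ρ (H^{−2} + ρ²)^{−1−iν} dρ = μ^{iν} H^{iν} K_{iν}(2μ H^{−1}), where (H^{−2}+ρ²)^{−1−iν} = exp((−1−iν) ln(H^{−2}+ρ²)) and μ^{iν}, H^{iν} are defined via the real logarithm. Equivalently, the Whittaker matrix element H^{−1}K_{iν}(2μH^{−1}) equals μ^{−iν} Γ(1+iν) H^{−iν−1} ∫_0^∞ J_0(2μρ) ρ (H^{−2}+ρ²)^{−1−iν} dρ. -/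
/-- The modified Bessel function `I_λ(x) = ∑_{k} (x/2)^{λ+2k}/(k! Γ(λ+k+1))`. -/
noncomputable def besselI (lam : ℂ) (x : ℂ) : ℂ :=
  ∑' k : ℕ, (x / 2) ^ (lam + 2 * (k : ℂ)) / ((k.factorial : ℂ) * Complex.Gamma (lam + k + 1))

/-- The Bessel–Macdonald function `K_λ(x) = π(I_{−λ}(x) − I_λ(x))/(2 sin(πλ))`. -/
noncomputable def besselK (lam : ℂ) (x : ℂ) : ℂ :=
  (Real.pi : ℂ) * (besselI (-lam) x - besselI lam x) / (2 * Complex.sin (Real.pi * lam))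

/-- The Bessel function of order zero, `J₀(x) = ∑_k (−1)^k (x/2)^{2k}/(k!)²`. -/
noncomputable def besselJ0 (x : ℝ) : ℝ :=
  ∑' k : ℕ, (-1) ^ k * (x / 2) ^ (2 * k) / ((k.factorial : ℝ)) ^ 2


/-- Coefficients -/
noncomputable def gco (n k : ℕ) : ℝ := (-1) ^ k / ((k.factorial : ℝ) * ((k + n).factorial : ℝ))

noncomputable def gser (n : ℕ) (y : ℝ) : ℝ := ∑' k : ℕ, gco n k * y ^ k

lemma gco_abs_le (n k : ℕ) : |gco n k| ≤ 1 / (k.factorial : ℝ) := by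
  unfold gco
  rw [abs_div, abs_pow, abs_neg, abs_one, one_pow]
  have h1 : (0 : ℝ) < k.factorial := by exact_mod_cast k.factorial_pos
  have h2 : (1 : ℝ) ≤ (k + n).factorial := by exact_mod_cast (k + n).factorial_pos
  rw [abs_of_pos (by positivity)]
  apply one_div_le_one_div_of_le h1
  nlinarith

lemma gser_summable (n : ℕ) (y : ℝ) : Summable (fun k : ℕ => gco n k * y ^ k) := by
  apply Summable.of_norm_bounded (g := fun k : ℕ => |y| ^ k / k.factorial)
    (Real.summable_pow_div_factorial |y|)
  intro k
  rw [Real.norm_eq_abs, abs_mul, abs_pow]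
  calc |gco n k| * |y| ^ k ≤ 1 / (k.factorial : ℝ) * |y| ^ k := by
        gcongr; exact gco_abs_le n k
    _ = _ := by ring

lemma gco_succ (n k : ℕ) : gco n (k + 1) * ((k + 1 : ℕ) : ℝ) = - gco (n + 1) k := by
  unfold gco
  have h1 : (k.factorial : ℝ) ≠ 0 := by exact_mod_cast k.factorial_ne_zero
  have h3 : ((k + 1 + n).factorial : ℝ) ≠ 0 := by exact_mod_cast (k + 1 + n).factorial_ne_zero
  have h4 : k + (n + 1) = k + 1 + n := by ring
  rw [h4, Nat.factorial_succ]
  push_cast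
  have h5 : (k : ℝ) + 1 ≠ 0 := by positivity
  field_simp
  ring

lemma gser_hasDerivAt (n : ℕ) (y : ℝ) : HasDerivAt (gser n) (- gser (n + 1) y) y := by
  have hR : (0 : ℝ) < |y| + 1 := by positivity
  have hu : Summable (fun k : ℕ => |gco n k| * (k : ℝ) * (|y| + 1) ^ (k - 1)) := by
    rw [← summable_nat_add_iff 1]
    have := (gser_summable (n + 1) (|y| + 1)).norm
    refine this.congr ?_
    intro k
    have := gco_succ n k
    rw [Real.norm_eq_abs, abs_mul, abs_pow, abs_of_pos hR]
    rw [← abs_neg (gco (n + 1) k), ← this, abs_mul]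
    simp only [Nat.add_sub_cancel, Nat.abs_cast]
  have key := hasDerivAt_tsum_of_isPreconnected (𝕜 := ℝ) (g := fun k y => gco n k * y ^ k)
    (g' := fun k y => gco n k * ((k : ℝ) * y ^ (k - 1))) (t := Metric.ball 0 (|y| + 1)) (y₀ := 0)
    (y := y) hu Metric.isOpen_ball (convex_ball (0 : ℝ) _).isPreconnected
    (fun k z _ => (hasDerivAt_pow k z).const_mul _) ?_ (Metric.mem_ball_self hR)
    (gser_summable n 0) (by simp)
  · refine HasDerivAt.congr_deriv key ?_
    symm
    rw [Summable.tsum_eq_zero_add]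
    · simp only [CharP.cast_eq_zero, zero_mul, mul_zero, zero_add, Nat.add_sub_cancel]
      unfold gser
      rw [← tsum_neg]
      congr 1
      ext k
      rw [← mul_assoc, gco_succ]
      ring
    · apply Summable.of_norm_bounded hu
      intro k
      rw [Real.norm_eq_abs, abs_mul, abs_mul, abs_pow, Nat.abs_cast, mul_assoc]
      gcongr
      linarith
  · intro k z hz
    rw [Real.norm_eq_abs, abs_mul, abs_mul, abs_pow, Nat.abs_cast, mul_assoc]
    have : |z| ≤ |y| + 1 := by
      simp at hz; exact hz.le
    gcongr

lemma gser_ode (y : ℝ) : y * gser 2 y - gser 1 y + gser 0 y = 0 := by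
  have h2 := (gser_summable 2 y).hasSum.mul_left y
  have h2' : HasSum (fun k : ℕ => if k = 0 then 0 else gco 2 (k - 1) * y ^ k) (y * gser 2 y) := by
    rw [← hasSum_nat_add_iff' 1]
    simp only [Nat.add_eq_zero_iff, one_ne_zero, and_false, if_false, Nat.add_sub_cancel,
      Finset.range_one, Finset.sum_singleton, if_true, sub_zero]
    have e : (fun n => gco 2 n * y ^ (n + 1)) = fun i => y * (gco 2 i * y ^ i) := by
      ext k; ring
    rw [e]
    exact h2
  have h1 := (gser_summable 1 y).hasSum
  have h0 := (gser_summable 0 y).hasSum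
  have h := (h2'.sub h1).add h0
  refine h.unique ?_
  convert hasSum_zero using 1
  ext k
  rcases k with _ | k
  · simp [gco]
  · simp only [Nat.add_eq_zero_iff, one_ne_zero, and_false, if_false, Nat.add_sub_cancel]
    rw [← sub_mul, ← add_mul]
    convert zero_mul _
    unfold gco
    have h1 : (k.factorial : ℝ) ≠ 0 := by exact_mod_cast k.factorial_ne_zero
    have h5 : (k : ℝ) + 1 ≠ 0 := by positivity
    have h6 : (k : ℝ) + 1 + 1 ≠ 0 := by positivity
    simp only [Nat.factorial_succ, add_zero]
    push_cast
    field_simp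
    ring

lemma besselJ0_eq (x : ℝ) : besselJ0 x = gser 0 (x ^ 2 / 4) := by
  unfold besselJ0 gser gco
  congr 1
  ext k
  rw [pow_mul]
  have : (x / 2) ^ 2 = x ^ 2 / 4 := by ring
  rw [this, add_zero]; ring

lemma besselJ0_hasDerivAt (x : ℝ) :
    HasDerivAt besselJ0 (- gser 1 (x ^ 2 / 4) * (x / 2)) x := by
  have h : besselJ0 = fun x => gser 0 (x ^ 2 / 4) := funext besselJ0_eq
  rw [h]
  have := (gser_hasDerivAt 0 (x ^ 2 / 4)).comp x (((hasDerivAt_pow 2 x).div_const 4))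
  refine HasDerivAt.congr_deriv this ?_
  simp
  left
  ring

lemma besselJ0_deriv2 (x : ℝ) (hx : 0 < x) :
    HasDerivAt (fun x => - gser 1 (x ^ 2 / 4) * (x / 2))
      (- (- gser 1 (x ^ 2 / 4) * (x / 2)) / x - besselJ0 x) x := by
  have h1 := ((gser_hasDerivAt 1 (x ^ 2 / 4)).comp x (((hasDerivAt_pow 2 x).div_const 4))).neg.mul
    ((hasDerivAt_id x).div_const 2)
  refine HasDerivAt.congr_deriv h1 ?_
  have := gser_ode (x ^ 2 / 4)
  rw [besselJ0_eq]
  simp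
  field_simp
  linear_combination 8 * this

lemma besselJ0_continuous : Continuous besselJ0 :=
  continuous_iff_continuousAt.2 fun x => (besselJ0_hasDerivAt x).continuousAt

lemma besselJ0_decay : ∃ C : ℝ, 0 ≤ C ∧ ∀ x : ℝ, 1 ≤ x → |besselJ0 x| ≤ C * x ^ (-(1 / 2) : ℝ) := by
  set f := besselJ0
  set h : ℝ → ℝ := fun x => - gser 1 (x ^ 2 / 4) * (x / 2) with hh
  set E : ℝ → ℝ := fun x => x * (h x ^ 2 + f x ^ 2) + f x * h x + f x ^ 2 / (2 * x) with hE
  have hd : ∀ x, 0 < x → HasDerivAt E (- f x ^ 2 / (2 * x ^ 2)) x := by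
    intro x hx
    have d1 : HasDerivAt f (h x) x := besselJ0_hasDerivAt x
    have d2 : HasDerivAt h (- h x / x - f x) x := besselJ0_deriv2 x hx
    have := (((hasDerivAt_id x).mul ((d2.pow 2).add (d1.pow 2))).add (d1.mul d2)).add
      ((d1.pow 2).div ((hasDerivAt_id x).const_mul 2) (by simpa using hx.ne'))
    refine HasDerivAt.congr_deriv this ?_
    simp
    field_simp
    ring
  have hanti : AntitoneOn E (Set.Ici 1) := by
    apply antitoneOn_of_deriv_nonpos (convex_Ici 1)
    · intro x hx
      exact (hd x (by simp at hx; linarith)).continuousAt.continuousWithinAt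
    · intro x hx
      simp at hx
      exact (hd x (by linarith)).differentiableAt.differentiableWithinAt
    · intro x hx
      simp at hx
      rw [(hd x (by linarith)).deriv, neg_div]
      have : 0 ≤ f x ^ 2 / (2 * x ^ 2) := by positivity
      linarith
  have hlow : ∀ x, 1 ≤ x → x * f x ^ 2 ≤ E x := by
    intro x hx
    have h0 : 0 < x := by linarith
    have : E x - x * f x ^ 2 = ((2 * x * h x + f x) ^ 2 + f x ^ 2) / (4 * x) := by
      simp only [hE]
      field_simp
      ring
    have h2 : 0 ≤ ((2 * x * h x + f x) ^ 2 + f x ^ 2) / (4 * x) := by positivity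
    linarith
  refine ⟨Real.sqrt (E 1), Real.sqrt_nonneg _, fun x hx => ?_⟩
  have h0 : 0 < x := by linarith
  have h1 : x * f x ^ 2 ≤ E 1 := (hlow x hx).trans (hanti (by simp) (by simpa using hx) hx)
  rw [Real.rpow_neg h0.le, ← Real.sqrt_eq_rpow, ← div_eq_mul_inv, le_div_iff₀ (Real.sqrt_pos.2 h0)]
  apply Real.le_sqrt_of_sq_le
  rw [mul_pow, Real.sq_sqrt h0.le, sq_abs]
  linarith

lemma hasSum_of_eq {f g : ℕ → ℂ} {a b : ℂ} (h : HasSum f a) (h1 : ∀ k, g k = f k) (h2 : b = a) :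
    HasSum g b := by
  rw [h2, show g = f from funext h1]; exact h

open MeasureTheory Set Filter Topology in
lemma inc_integrable_real (q w : ℝ) (hw : 0 < w) :
    IntegrableOn (fun t : ℝ => t ^ q * Real.exp (-(w * t))) (Ioi 1) := by
  have h := integrableOn_rpow_mul_exp_neg_mul_rpow (s := max q 0) (p := 1) (b := w)
    (by have := le_max_right q 0; linarith) zero_lt_one hw
  have h' := h.mono_set (Ioi_subset_Ioi zero_le_one)
  refine Integrable.mono' h' ?_ ?_
  · apply ContinuousOn.aestronglyMeasurable _ measurableSet_Ioi
    intro t ht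
    have : t ≠ 0 := by simp at ht; linarith
    apply ContinuousAt.continuousWithinAt
    exact (Real.continuousAt_rpow_const _ _ (Or.inl this)).mul (by fun_prop)
  · refine (ae_restrict_iff' measurableSet_Ioi).2 (Eventually.of_forall fun t ht => ?_)
    have ht1 : 1 < t := ht
    have h0 : 0 < t := by linarith
    rw [Real.norm_eq_abs, abs_of_nonneg (by positivity), Real.rpow_one, neg_mul]
    gcongr
    · exact ht1.le
    · exact le_max_left _ _

open MeasureTheory Set Filter Topology in
lemma inc_norm (c : ℂ) (w t : ℝ) (ht : 0 < t) :
    ‖(t : ℂ) ^ c * Complex.exp (-((w : ℂ) * t))‖ = t ^ c.re * Real.exp (-(w * t)) := by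
  rw [norm_mul, Complex.norm_cpow_eq_rpow_re_of_pos ht, Complex.norm_exp]
  simp

open MeasureTheory Set Filter Topology in
lemma inc_integrable (c : ℂ) (w : ℝ) (hw : 0 < w) :
    IntegrableOn (fun t : ℝ => (t : ℂ) ^ c * Complex.exp (-((w : ℂ) * t))) (Ioi 1) := by
  refine Integrable.mono' (inc_integrable_real c.re w hw) ?_ ?_
  · apply ContinuousOn.aestronglyMeasurable _ measurableSet_Ioi
    intro t ht
    have : t ≠ 0 := by simp at ht; linarith
    apply ContinuousAt.continuousWithinAt
    exact (Complex.continuousAt_ofReal_cpow_const _ _ (Or.inr this)).mul (by fun_prop)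
  · refine (ae_restrict_iff' measurableSet_Ioi).2 (Eventually.of_forall fun t ht => ?_)
    have ht1 : 1 < t := ht
    exact (inc_norm c w t (by linarith)).le

noncomputable def Einc (c : ℂ) (w : ℝ) : ℂ :=
  ∫ t in Set.Ioi (1 : ℝ), (t : ℂ) ^ (c - 1) * Complex.exp (-((w : ℂ) * t))

open MeasureTheory Set Filter Topology in
lemma Einc_rec (c : ℂ) (hc : c ≠ 0) (w : ℝ) (hw : 0 < w) :
    c * Einc c w = - Complex.exp (-w) + w * Einc (c + 1) w := by
  have hd : ∀ t ∈ Ici (1 : ℝ), HasDerivAt (fun t : ℝ => (t : ℂ) ^ c * Complex.exp (-((w : ℂ) * t)))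
      (c * ((t : ℂ) ^ (c - 1) * Complex.exp (-((w : ℂ) * t))) -
        w * ((t : ℂ) ^ c * Complex.exp (-((w : ℂ) * t)))) t := by
    intro t ht
    have ht1 : (1 : ℝ) ≤ t := ht
    have h1 : HasDerivAt (fun z : ℂ => z ^ c * Complex.exp (-((w : ℂ) * z)))
        ((c * (t : ℂ) ^ (c - 1) * 1) * Complex.exp (-((w : ℂ) * t)) +
          (t : ℂ) ^ c * (Complex.exp (-((w : ℂ) * t)) * (-((w : ℂ) * 1)))) (t : ℂ) := by
      refine HasDerivAt.mul ?_ ?_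
      · refine (hasDerivAt_id (t : ℂ)).cpow_const ?_
        left; simp; linarith
      · exact (((hasDerivAt_id (t : ℂ)).const_mul (w : ℂ)).neg).cexp
    refine h1.comp_ofReal.congr_deriv ?_
    ring
  have i1 : IntegrableOn (fun t : ℝ => (c * ((t : ℂ) ^ (c - 1) * Complex.exp (-((w : ℂ) * t))) -
        w * ((t : ℂ) ^ c * Complex.exp (-((w : ℂ) * t))))) (Ioi 1) :=
    ((inc_integrable (c - 1) w hw).const_mul c).sub ((inc_integrable c w hw).const_mul (w : ℂ))
  have ht := tendsto_zero_of_hasDerivAt_of_integrableOn_Ioi (fun t ht => hd t (Ioi_subset_Ici_self ht)) i1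
    (inc_integrable c w hw)
  have := integral_Ioi_of_hasDerivAt_of_tendsto' hd i1 ht
  rw [integral_sub ((inc_integrable (c - 1) w hw).const_mul c)
    ((inc_integrable c w hw).const_mul (w : ℂ)), integral_const_mul, integral_const_mul] at this
  unfold Einc
  rw [add_sub_cancel_right]
  simp only [Complex.ofReal_one, Complex.one_cpow, mul_one, one_mul, zero_sub] at this
  rw [← this]; ring

open MeasureTheory Set Filter Topology in
lemma exp_hasSum (z : ℂ) : HasSum (fun k : ℕ => z ^ k / (k.factorial : ℂ)) (Complex.exp z) := by
  rw [Complex.exp_eq_exp_ℂ]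
  exact NormedSpace.expSeries_div_hasSum_exp z

open MeasureTheory Set Filter Topology in
lemma inc_sum_pos (c : ℂ) (hc : 0 < c.re) (w : ℝ) (hw : 0 < w) :
    HasSum (fun k : ℕ => (-(w : ℂ)) ^ k / (k.factorial * (k + c)))
      ((1 / (w : ℂ)) ^ c * Complex.Gamma c - Einc c w) := by
  have hG := Complex.integral_cpow_mul_exp_neg_mul_Ioi hc hw
  have hint : IntegrableOn (fun t : ℝ => (t : ℂ) ^ (c - 1) * Complex.exp (-((w : ℂ) * t)))
      (Ioc 0 1) := by
    have h1 : IntegrableOn (fun t : ℝ => (t : ℂ) ^ (c - 1)) (Ioc 0 1) := by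
      rw [← intervalIntegrable_iff_integrableOn_Ioc_of_le zero_le_one]
      exact intervalIntegral.intervalIntegrable_cpow' (by simpa using hc)
    refine Integrable.mul_bdd (c := 1) h1 (by fun_prop) ?_
    refine (ae_restrict_iff' measurableSet_Ioc).2 (Eventually.of_forall fun t ht => ?_)
    rw [Complex.norm_exp]
    have := ht.1
    simp
    positivity
  rw [← Ioc_union_Ioi_eq_Ioi (zero_le_one (α := ℝ)), setIntegral_union Ioc_disjoint_Ioi_same
    measurableSet_Ioi hint (inc_integrable _ w hw)] at hG
  rw [← hG]
  unfold Einc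
  rw [add_sub_cancel_right]
  have hkc : ∀ k : ℕ, (k : ℂ) + c ≠ 0 := by
    intro k h
    have := congrArg Complex.re h
    simp at this
    have : (0 : ℝ) ≤ k := by positivity
    linarith
  have hii : ∀ k : ℕ, IntegrableOn (fun t : ℝ => (t : ℂ) ^ ((k : ℂ) + c - 1)) (Ioc 0 1) := by
    intro k
    rw [← intervalIntegrable_iff_integrableOn_Ioc_of_le zero_le_one]
    apply intervalIntegral.intervalIntegrable_cpow'
    simp
    have : (0 : ℝ) ≤ k := by positivity
    linarith
  have key := hasSum_integral_of_summable_integral_norm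
    (μ := volume.restrict (Ioc (0 : ℝ) 1))
    (F := fun (k : ℕ) (t : ℝ) => (-(w : ℂ)) ^ k / (k.factorial : ℂ) * (t : ℂ) ^ ((k : ℂ) + c - 1))
    (fun k => (hii k).const_mul _) ?_
  · refine hasSum_of_eq key ?_ ?_
    · intro k
      rw [integral_const_mul, ← intervalIntegral.integral_of_le zero_le_one, integral_cpow]
      · simp only [sub_add_cancel, Complex.ofReal_one, Complex.one_cpow, Complex.ofReal_zero,
          Complex.zero_cpow (hkc k), sub_zero]
        rw [div_mul_div_comm, mul_one]
      · left
        simp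
        have : (0 : ℝ) ≤ k := by positivity
        linarith
    · refine setIntegral_congr_fun measurableSet_Ioc fun t ht => ?_
      have ht0 : (t : ℂ) ≠ 0 := by exact_mod_cast ht.1.ne'
      have := ((exp_hasSum (-((w : ℂ) * t))).mul_left ((t : ℂ) ^ (c - 1))).tsum_eq
      rw [← this]
      congr 1
      ext k
      rw [add_sub_assoc, Complex.cpow_add _ _ ht0, Complex.cpow_natCast, ← neg_mul, mul_pow]
      ring
  · refine Summable.of_nonneg_of_le (fun k => integral_nonneg fun _ => norm_nonneg _) (fun k => ?_)
      ((Real.summable_pow_div_factorial w).mul_right (∫ t in Ioc (0 : ℝ) 1, ‖(t : ℂ) ^ ((0 : ℕ) + c - 1)‖))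
    rw [← integral_const_mul]
    refine setIntegral_mono_on ((hii k).const_mul _).norm ((hii 0).norm.const_mul _)
      measurableSet_Ioc fun t ht => ?_
    rw [norm_mul, norm_div, norm_pow, norm_neg, Complex.norm_real, Real.norm_eq_abs,
      abs_of_pos hw, Complex.norm_natCast]
    gcongr
    rw [Complex.norm_cpow_eq_rpow_re_of_pos ht.1, Complex.norm_cpow_eq_rpow_re_of_pos ht.1]
    apply Real.rpow_le_rpow_of_exponent_ge ht.1 ht.2
    simp

open MeasureTheory Set Filter Topology in
lemma inc_sum_step (c : ℂ) (hc : c.im ≠ 0) (w : ℝ) (hw : 0 < w)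
    (h : HasSum (fun k : ℕ => (-(w : ℂ)) ^ k / (k.factorial * (k + (c + 1))))
      ((1 / (w : ℂ)) ^ (c + 1) * Complex.Gamma (c + 1) - Einc (c + 1) w)) :
    HasSum (fun k : ℕ => (-(w : ℂ)) ^ k / (k.factorial * (k + c)))
      ((1 / (w : ℂ)) ^ c * Complex.Gamma c - Einc c w) := by
  have hc0 : c ≠ 0 := by rintro rfl; simp at hc
  have hkc : ∀ k : ℕ, (k : ℂ) + c ≠ 0 := by
    intro k h
    have := congrArg Complex.im h
    simp at this
    exact hc this
  have hw0 : (w : ℂ) ≠ 0 := by exact_mod_cast hw.ne'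
  have hE := Einc_rec c hc0 w hw
  have h2 : HasSum (fun k : ℕ => if k = 0 then 0 else
      (-(w : ℂ)) ^ k * k / (k.factorial * (k + c)))
      (-w * ((1 / (w : ℂ)) ^ (c + 1) * Complex.Gamma (c + 1) - Einc (c + 1) w)) := by
    rw [← hasSum_nat_add_iff' 1]
    simp only [Nat.add_eq_zero_iff, one_ne_zero, and_false, if_false,
      Finset.range_one, Finset.sum_singleton, if_true, sub_zero]
    have := h.mul_left (-(w : ℂ))
    refine hasSum_of_eq this (fun k => ?_) rfl
    have h1 : (k.factorial : ℂ) ≠ 0 := by exact_mod_cast k.factorial_ne_zero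
    have h2 : (k : ℂ) + (c + 1) ≠ 0 := by have := hkc (k + 1); push_cast at this; convert this using 1; ring
    have h3 : (k : ℂ) + 1 + c ≠ 0 := by have := hkc (k + 1); push_cast at this; convert this using 1
    have h4 : (k : ℂ) + 1 ≠ 0 := by exact_mod_cast k.succ_ne_zero
    rw [Nat.factorial_succ]
    push_cast
    field_simp
    ring
  have h3 := ((exp_hasSum (-(w : ℂ))).sub h2).mul_left c⁻¹
  refine hasSum_of_eq h3 ?_ ?_
  · intro k
    have h1 : (k.factorial : ℂ) ≠ 0 := by exact_mod_cast k.factorial_ne_zero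
    have h2 := hkc k
    rcases k with _ | k
    · simp
    · simp only [Nat.add_eq_zero_iff, one_ne_zero, and_false, if_false]
      field_simp
      ring
  · have : Einc c w = c⁻¹ * (- Complex.exp (-w) + w * Einc (c + 1) w) := by
      rw [← hE]; field_simp
    rw [this, Complex.Gamma_add_one _ hc0, Complex.cpow_add _ _ (by simpa using hw0), Complex.cpow_one]
    field_simp
    ring

open MeasureTheory Set Filter Topology in
lemma inc_sum (c : ℂ) (hc : c.im ≠ 0) (w : ℝ) (hw : 0 < w) :
    HasSum (fun k : ℕ => (-(w : ℂ)) ^ k / (k.factorial * (k + c)))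
      ((1 / (w : ℂ)) ^ c * Complex.Gamma c - Einc c w) := by
  have : ∀ n : ℕ, ∀ c : ℂ, c.im ≠ 0 → 0 < c.re + n →
    HasSum (fun k : ℕ => (-(w : ℂ)) ^ k / (k.factorial * (k + c)))
      ((1 / (w : ℂ)) ^ c * Complex.Gamma c - Einc c w) := by
    intro n
    induction n with
    | zero => intro c _ h; exact inc_sum_pos c (by simpa using h) w hw
    | succ n ih =>
      intro c hc h
      apply inc_sum_step c hc w hw
      apply ih (c + 1) (by simpa using hc)
      push_cast at h
      simp; linarith
  obtain ⟨n, hn⟩ := exists_nat_gt (-c.re)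
  exact this n c hc (by linarith)


noncomputable def Mint (s : ℂ) (α β : ℝ) : ℂ :=
  ∫ t in Set.Ioi (1 : ℝ), (t : ℂ) ^ (s - 1) * Complex.exp (-((α : ℂ) * t)) *
    Complex.exp (-((β : ℂ) / t))

open MeasureTheory Set Filter Topology in
lemma Mint_hasSum (s : ℂ) (α β : ℝ) (hα : 0 < α) (hβ : 0 < β) :
    HasSum (fun k : ℕ => (-(β : ℂ)) ^ k / (k.factorial : ℂ) * Einc (s - k) α) (Mint s α β) := by
  have key := hasSum_integral_of_summable_integral_norm
    (μ := volume.restrict (Ioi (1 : ℝ)))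
    (F := fun (k : ℕ) (t : ℝ) => (-(β : ℂ)) ^ k / (k.factorial : ℂ) *
      ((t : ℂ) ^ (s - k - 1) * Complex.exp (-((α : ℂ) * t))))
    (fun k => (inc_integrable _ α hα).const_mul _) ?_
  · refine hasSum_of_eq key ?_ ?_
    · intro k
      rw [integral_const_mul, Einc]
    · refine setIntegral_congr_fun measurableSet_Ioi fun t ht => ?_
      have ht1 : (1 : ℝ) < t := ht
      have ht0 : (t : ℂ) ≠ 0 := by
        have : t ≠ 0 := by linarith
        exact_mod_cast this
      have := ((exp_hasSum (-((β : ℂ) / t))).mul_left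
        ((t : ℂ) ^ (s - 1) * Complex.exp (-((α : ℂ) * t)))).tsum_eq
      rw [← this]
      congr 1
      ext k
      rw [show s - k - 1 = s - 1 - k by ring, Complex.cpow_sub (s - 1) _ ht0, Complex.cpow_natCast,
        ← neg_div, div_pow]
      ring
  · refine Summable.of_nonneg_of_le (fun k => integral_nonneg fun _ => norm_nonneg _) (fun k => ?_)
      ((Real.summable_pow_div_factorial β).mul_right
        (∫ t in Ioi (1 : ℝ), ‖(t : ℂ) ^ (s - (0 : ℕ) - 1) * Complex.exp (-((α : ℂ) * t))‖))
    rw [← integral_const_mul]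
    refine setIntegral_mono_on ((inc_integrable _ α hα).const_mul _).norm
      ((inc_integrable _ α hα).norm.const_mul _) measurableSet_Ioi fun t ht => ?_
    have ht1 : (1 : ℝ) < t := ht
    have ht0 : 0 < t := by linarith
    rw [norm_mul, norm_div, norm_pow, norm_neg, Complex.norm_real, Real.norm_eq_abs,
      abs_of_pos hβ, Complex.norm_natCast, inc_norm _ _ _ ht0, inc_norm _ _ _ ht0]
    have hre : (s - k - 1).re ≤ (s - (0 : ℕ) - 1).re := by simp
    exact mul_le_mul_of_nonneg_left (mul_le_mul_of_nonneg_right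
      (Real.rpow_le_rpow_of_exponent_le ht1.le hre) (by positivity)) (by positivity)

noncomputable def Dterm (s : ℂ) (α β : ℝ) (p : ℕ × ℕ) : ℂ :=
  (-(β : ℂ)) ^ p.1 / (p.1.factorial : ℂ) *
    ((-(α : ℂ)) ^ p.2 / (p.2.factorial * (p.2 + (s - p.1))))

lemma Dterm_summable (s : ℂ) (hs : s.im ≠ 0) (α β : ℝ) (hα : 0 < α) (hβ : 0 < β) :
    Summable (Dterm s α β) := by
  have h := ((Real.summable_pow_div_factorial β).mul_of_nonneg
    (Real.summable_pow_div_factorial α) (fun k => by positivity) (fun k => by positivity)).mul_right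
      (1 / |s.im|)
  refine Summable.of_norm_bounded h ?_
  rintro ⟨k, j⟩
  unfold Dterm
  have h1 : |s.im| ≤ ‖(j : ℂ) + (s - k)‖ := by
    have := Complex.abs_im_le_norm ((j : ℂ) + (s - k))
    simpa using this
  have h2 : 0 < |s.im| := abs_pos.2 hs
  simp only [norm_mul, norm_div, norm_pow, norm_neg, Complex.norm_real, Real.norm_eq_abs,
      abs_of_pos hβ, abs_of_pos hα, Complex.norm_natCast]
  rw [mul_assoc]
  gcongr
  rw [div_mul_div_comm, mul_one]
  gcongr

lemma Dterm_swap (s : ℂ) (α β : ℝ) :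
    ∑' p, Dterm (-s) β α p = - ∑' p, Dterm s α β p := by
  rw [← (Equiv.prodComm ℕ ℕ).tsum_eq, ← tsum_neg]
  congr 1
  ext ⟨k, j⟩
  simp only [Dterm, Equiv.prodComm_apply, Prod.swap_prod_mk]
  rw [show (k : ℂ) + (-s - j) = -(j + (s - k)) by ring, mul_neg, div_neg, mul_neg,
    div_mul_div_comm, div_mul_div_comm]
  congr 1
  rw [mul_comm]
  congr 1
  ring

lemma Mint_add (s : ℂ) (hs : s.im ≠ 0) (α β : ℝ) (hα : 0 < α) (hβ : 0 < β) :
    HasSum (fun k : ℕ => (-(β : ℂ)) ^ k / (k.factorial : ℂ) *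
      ((1 / (α : ℂ)) ^ (s - k) * Complex.Gamma (s - k)))
      (Mint s α β + ∑' p, Dterm s α β p) := by
  have h2 : HasSum (fun k : ℕ => (-(β : ℂ)) ^ k / (k.factorial : ℂ) *
      ((1 / (α : ℂ)) ^ (s - k) * Complex.Gamma (s - k) - Einc (s - k) α)) (∑' p, Dterm s α β p) := by
    refine (Dterm_summable s hs α β hα hβ).hasSum.prod_fiberwise ?_
    intro k
    have h := (inc_sum (s - k) (by simpa using hs) α hα).mul_left
      ((-(β : ℂ)) ^ k / (k.factorial : ℂ))
    exact hasSum_of_eq h (fun j => by simp only [Dterm]) rfl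
  refine hasSum_of_eq ((Mint_hasSum s α β hα hβ).add h2) (fun k => ?_) rfl
  ring

lemma Gamma_refl (s : ℂ) (hs : s.im ≠ 0) (k : ℕ) :
    Complex.Gamma (s - k) = Real.pi / Complex.sin (Real.pi * s) * ((-1) ^ k /
      Complex.Gamma (-s + k + 1)) := by
  have h := Complex.Gamma_mul_Gamma_one_sub (s - k)
  rw [show 1 - (s - k) = -s + k + 1 by ring, mul_sub, mul_comm (Real.pi : ℂ) (k : ℂ),
    Complex.sin_antiperiodic.sub_nat_mul_eq] at h
  have hG : Complex.Gamma (-s + k + 1) ≠ 0 := by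
    apply Complex.Gamma_ne_zero
    intro m hm
    have := congrArg Complex.im hm
    simp at this
    exact hs this
  rw [eq_div_of_mul_eq hG h]
  rcases neg_one_pow_eq_or ℂ k with h | h <;> rw [h] <;> simp [div_eq_mul_inv]

lemma Mint_bessel (s : ℂ) (hs : s.im ≠ 0) (a μ : ℝ) (ha : 0 < a) (hμ : 0 < μ) :
    Mint s (a ^ 2) (μ ^ 2) + ∑' p, Dterm s (a ^ 2) (μ ^ 2) p =
      ((μ / a : ℝ) : ℂ) ^ s * (Real.pi / Complex.sin (Real.pi * s)) *
        besselI (-s) (2 * (μ * a : ℝ)) := by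
  have h := Mint_add s hs (a ^ 2) (μ ^ 2) (by positivity) (by positivity)
  rw [← h.tsum_eq, besselI, ← tsum_mul_left]
  congr 1
  ext k
  rw [Gamma_refl s hs]
  have e1 : (2 * ((μ * a : ℝ) : ℂ)) / 2 = ((μ * a : ℝ) : ℂ) := by ring
  have hz : ((μ * a : ℝ) : ℂ) ≠ 0 := by
    have : μ * a ≠ 0 := by positivity
    exact_mod_cast this
  have ha0 : (a : ℂ) ≠ 0 := by exact_mod_cast ha.ne'
  have e2 : ((μ * a : ℝ) : ℂ) ^ (-s + 2 * (k : ℂ)) =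
      ((μ * a : ℝ) : ℂ) ^ (-s) * ((μ : ℂ) * a) ^ (2 * k) := by
    rw [Complex.cpow_add _ _ hz]
    congr 1
    rw [show 2 * (k : ℂ) = ((2 * k : ℕ) : ℂ) by push_cast; ring, Complex.cpow_natCast]
    push_cast; ring
  have e3 : (1 / ((a ^ 2 : ℝ) : ℂ)) ^ (s - k) = (((1 / a ^ 2 : ℝ)) : ℂ) ^ s * ((a : ℂ) ^ 2) ^ k := by
    have : 1 / ((a ^ 2 : ℝ) : ℂ) = (((1 / a ^ 2 : ℝ)) : ℂ) := by push_cast; ring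
    rw [this, Complex.cpow_sub _ _ (by rw [← this]; simp [ha0]), Complex.cpow_natCast]
    push_cast
    rw [one_div, inv_pow, div_inv_eq_mul]
  have e4 : (((1 / a ^ 2 : ℝ)) : ℂ) ^ s = ((μ / a : ℝ) : ℂ) ^ s * ((μ * a : ℝ) : ℂ) ^ (-s) := by
    have : (1 / a ^ 2 : ℝ) = (μ / a) * (μ * a)⁻¹ := by field_simp
    rw [this, Complex.ofReal_mul, Complex.mul_cpow_ofReal_nonneg (by positivity) (by positivity),
      Complex.cpow_neg, Complex.ofReal_inv, Complex.inv_cpow]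
    rw [Complex.arg_ofReal_of_nonneg (by positivity)]
    exact Real.pi_pos.ne
  rw [e1, e2, e3, e4]
  rw [show (-(((μ ^ 2 : ℝ)) : ℂ)) ^ k = (-1) ^ k * (μ : ℂ) ^ (2 * k) by
    rw [neg_pow]; push_cast; rw [pow_mul]]
  have e5 : ((-1 : ℂ) ^ k) * (-1) ^ k = 1 := by rw [← mul_pow]; simp
  rw [mul_pow (μ : ℂ) a, ← pow_mul (a : ℂ)]
  calc _ = ((-1 : ℂ) ^ k * (-1) ^ k) * (((μ / a : ℝ) : ℂ) ^ s * (Real.pi / Complex.sin (Real.pi * s)) *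
    (((μ * a : ℝ) : ℂ) ^ (-s) * ((μ : ℂ) ^ (2 * k) * (a : ℂ) ^ (2 * k)) /
      ((k.factorial : ℂ) * Complex.Gamma (-s + k + 1)))) := by
        ring
    _ = _ := by rw [e5, one_mul]

open MeasureTheory Set Filter Topology in
lemma Mint_integrable (s : ℂ) (α β : ℝ) (hα : 0 < α) (hβ : 0 < β) :
    IntegrableOn (fun t : ℝ => (t : ℂ) ^ (s - 1) * Complex.exp (-((α : ℂ) * t)) *
      Complex.exp (-((β : ℂ) / t))) (Ioi 1) := by
  refine Integrable.mul_bdd (c := 1) (inc_integrable _ α hα) ?_ ?_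
  · apply Measurable.aestronglyMeasurable
    fun_prop
  · refine (ae_restrict_iff' measurableSet_Ioi).2 (Eventually.of_forall fun t ht => ?_)
    have ht1 : (1 : ℝ) < t := ht
    have ht0 : 0 < t := by linarith
    rw [show -((β : ℂ) / t) = ((-(β / t) : ℝ) : ℂ) by push_cast; ring, Complex.norm_exp,
      Complex.ofReal_re]
    apply Real.exp_le_one_iff.2
    have : 0 < β / t := by positivity
    linarith

open MeasureTheory Set Filter Topology in
lemma full_split (s : ℂ) (α β : ℝ) (hα : 0 < α) (hβ : 0 < β) :
    ∫ t in Ioi (0 : ℝ), (t : ℂ) ^ (s - 1) * Complex.exp (-((α : ℂ) * t)) *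
      Complex.exp (-((β : ℂ) / t)) = Mint s α β + Mint (-s) β α := by
  set f : ℝ → ℂ := fun t => (t : ℂ) ^ (s - 1) * Complex.exp (-((α : ℂ) * t)) *
      Complex.exp (-((β : ℂ) / t)) with hf
  have himg : (fun t : ℝ => t⁻¹) '' Ioi 1 = Ioo 0 1 := by
    ext x
    constructor
    · rintro ⟨t, ht, rfl⟩
      have ht1 : (1 : ℝ) < t := ht
      exact ⟨by positivity, inv_lt_one_of_one_lt₀ ht1⟩
    · rintro ⟨h0, h1⟩
      exact ⟨x⁻¹, (one_lt_inv₀ h0).2 h1, inv_inv x⟩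
  have hder : ∀ t ∈ Ioi (1 : ℝ), HasDerivWithinAt (fun t : ℝ => t⁻¹) (-(t ^ 2)⁻¹) (Ioi 1) t := by
    intro t ht
    have ht1 : (1 : ℝ) < t := ht
    exact (hasDerivAt_inv (by linarith)).hasDerivWithinAt
  have hinj : InjOn (fun t : ℝ => t⁻¹) (Ioi 1) := fun x _ y _ h => inv_injective h
  have heq : ∀ t ∈ Ioi (1 : ℝ), |(-(t ^ 2)⁻¹)| • f t⁻¹ = (t : ℂ) ^ (-s - 1) *
      Complex.exp (-((β : ℂ) * t)) * Complex.exp (-((α : ℂ) / t)) := by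
    intro t ht
    have ht1 : (1 : ℝ) < t := ht
    have ht0 : 0 < t := by linarith
    have htc : (t : ℂ) ≠ 0 := by exact_mod_cast ht0.ne'
    rw [abs_neg, abs_of_pos (by positivity)]
    simp only [hf, Complex.real_smul]
    push_cast
    rw [Complex.inv_cpow _ _ (by rw [Complex.arg_ofReal_of_nonneg ht0.le]; exact Real.pi_pos.ne),
      div_inv_eq_mul, ← div_eq_mul_inv, Complex.cpow_sub _ _ htc, Complex.cpow_sub _ _ htc,
      Complex.cpow_neg, Complex.cpow_one]
    have : (t : ℂ) ^ s ≠ 0 := by simp [Complex.cpow_eq_zero_iff, htc]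
    field_simp
  have hi := integral_image_eq_integral_abs_deriv_smul measurableSet_Ioi hder hinj f
  have hi2 := integrableOn_image_iff_integrableOn_abs_deriv_smul measurableSet_Ioi hder hinj f
  rw [himg] at hi hi2
  rw [setIntegral_congr_fun measurableSet_Ioi heq] at hi
  have hi3 : IntegrableOn f (Ioo 0 1) := by
    rw [hi2]
    exact (integrableOn_congr_fun heq measurableSet_Ioi).2 (Mint_integrable (-s) β α hβ hα)
  have hi4 : IntegrableOn f (Ioc 0 1) := by rwa [integrableOn_Ioc_iff_integrableOn_Ioo]
  rw [← Ioc_union_Ioi_eq_Ioi (zero_le_one (α := ℝ)), setIntegral_union Ioc_disjoint_Ioi_same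
    measurableSet_Ioi hi4 (Mint_integrable s α β hα hβ),
    integral_Ioc_eq_integral_Ioo, hi, add_comm]
  rfl

open MeasureTheory Set Filter Topology in
lemma macdonald (s : ℂ) (hs : s.im ≠ 0) (a μ : ℝ) (ha : 0 < a) (hμ : 0 < μ) :
    ∫ t in Ioi (0 : ℝ), (t : ℂ) ^ (s - 1) * Complex.exp (-(((a ^ 2 : ℝ) : ℂ) * t)) *
      Complex.exp (-(((μ ^ 2 : ℝ) : ℂ) / t)) =
      2 * ((μ / a : ℝ) : ℂ) ^ s * besselK s (2 * (μ * a : ℝ)) := by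
  rw [full_split s _ _ (by positivity) (by positivity)]
  have h1 := Mint_bessel s hs a μ ha hμ
  have h2 := Mint_bessel (-s) (by simpa using hs) μ a hμ ha
  rw [Dterm_swap, neg_neg, mul_comm a μ] at h2
  have e : ((a / μ : ℝ) : ℂ) ^ (-s) = ((μ / a : ℝ) : ℂ) ^ s := by
    rw [show a / μ = (μ / a)⁻¹ by rw [inv_div], Complex.ofReal_inv, Complex.inv_cpow, Complex.cpow_neg,
      inv_inv]
    rw [Complex.arg_ofReal_of_nonneg (by positivity)]
    exact Real.pi_pos.ne
  rw [e, mul_neg (Real.pi : ℂ) s, Complex.sin_neg, div_neg] at h2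
  rw [besselK]
  calc _ = (Mint s (a ^ 2) (μ ^ 2) + ∑' p, Dterm s (a ^ 2) (μ ^ 2) p) +
    (Mint (-s) (μ ^ 2) (a ^ 2) + - ∑' p, Dterm s (a ^ 2) (μ ^ 2) p) := by ring
    _ = _ := by
      rw [h1, h2, mul_comm (2 : ℂ) (Complex.sin _), ← div_div]
      ring


open MeasureTheory Set Filter Topology in
lemma gauss_moment (t : ℝ) (ht : 0 < t) (k : ℕ) :
    IntegrableOn (fun ρ : ℝ => ρ ^ (2 * k + 1) * Real.exp (-(t * ρ ^ 2))) (Ioi 0) ∧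
    ∫ ρ in Ioi (0 : ℝ), ρ ^ (2 * k + 1) * Real.exp (-(t * ρ ^ 2)) =
      k.factorial / (2 * t ^ (k + 1)) := by
  have hq : (-1 : ℝ) < ((2 * k + 1 : ℕ) : ℝ) := by
    have : (0 : ℝ) ≤ ((2 * k + 1 : ℕ) : ℝ) := Nat.cast_nonneg _
    linarith
  have h1 := integrableOn_rpow_mul_exp_neg_mul_rpow (p := 2) (s := ((2 * k + 1 : ℕ) : ℝ)) (b := t)
    hq two_pos ht
  have h2 := integral_rpow_mul_exp_neg_mul_rpow (p := 2) (q := ((2 * k + 1 : ℕ) : ℝ)) (b := t)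
    two_pos hq ht
  simp only [Real.rpow_natCast, Real.rpow_two, neg_mul] at h1 h2
  refine ⟨h1, h2.trans ?_⟩
  have e : (((2 * k + 1 : ℕ) : ℝ) + 1) / 2 = k + 1 := by push_cast; ring
  rw [neg_div, e, Real.Gamma_nat_eq_factorial, Real.rpow_neg ht.le]
  rw [show (k : ℝ) + 1 = ((k + 1 : ℕ) : ℝ) by push_cast; ring, Real.rpow_natCast]
  field_simp

open MeasureTheory Set Filter Topology in
lemma gauss_bessel (t μ : ℝ) (ht : 0 < t) (hμ : 0 < μ) :
    ∫ ρ in Ioi (0 : ℝ), besselJ0 (2 * μ * ρ) * ρ * Real.exp (-(t * ρ ^ 2)) =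
      1 / (2 * t) * Real.exp (-(μ ^ 2 / t)) := by
  have hnorm : ∀ k : ℕ, ∫ ρ in Ioi (0 : ℝ), ‖(-1) ^ k * μ ^ (2 * k) / (k.factorial : ℝ) ^ 2 *
      (ρ ^ (2 * k + 1) * Real.exp (-(t * ρ ^ 2)))‖ = 1 / (2 * t) * ((μ ^ 2 / t) ^ k / k.factorial) := by
    intro k
    have : ∀ ρ ∈ Ioi (0 : ℝ), ‖(-1) ^ k * μ ^ (2 * k) / (k.factorial : ℝ) ^ 2 *
      (ρ ^ (2 * k + 1) * Real.exp (-(t * ρ ^ 2)))‖ = μ ^ (2 * k) / (k.factorial : ℝ) ^ 2 *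
      (ρ ^ (2 * k + 1) * Real.exp (-(t * ρ ^ 2))) := by
      intro ρ hρ
      have h0 : (0 : ℝ) < ρ := hρ
      rw [mul_div_assoc, mul_assoc, norm_mul, norm_pow, norm_neg, norm_one, one_pow, one_mul,
        Real.norm_eq_abs, abs_of_pos]
      positivity
    rw [setIntegral_congr_fun measurableSet_Ioi this, integral_const_mul, (gauss_moment t ht k).2]
    have h1 : (k.factorial : ℝ) ≠ 0 := by exact_mod_cast k.factorial_ne_zero
    rw [div_pow, ← pow_mul]
    field_simp
    try ring
  have key := hasSum_integral_of_summable_integral_norm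
    (μ := volume.restrict (Ioi (0 : ℝ)))
    (F := fun (k : ℕ) (ρ : ℝ) => (-1) ^ k * μ ^ (2 * k) / (k.factorial : ℝ) ^ 2 *
      (ρ ^ (2 * k + 1) * Real.exp (-(t * ρ ^ 2))))
    (fun k => (gauss_moment t ht k).1.const_mul _) ?_
  · have e1 : ∫ ρ in Ioi (0 : ℝ), besselJ0 (2 * μ * ρ) * ρ * Real.exp (-(t * ρ ^ 2)) =
        ∫ ρ in Ioi (0 : ℝ), ∑' k : ℕ, (-1) ^ k * μ ^ (2 * k) / (k.factorial : ℝ) ^ 2 *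
          (ρ ^ (2 * k + 1) * Real.exp (-(t * ρ ^ 2))) := by
      refine setIntegral_congr_fun measurableSet_Ioi fun ρ hρ => ?_
      simp only [besselJ0]
      rw [← tsum_mul_right, ← tsum_mul_right]
      congr 1
      ext k
      rw [show 2 * μ * ρ / 2 = μ * ρ by ring, mul_pow]
      ring
    rw [e1]
    refine key.unique ?_
    have h := (NormedSpace.expSeries_div_hasSum_exp (𝔸 := ℝ) (-(μ ^ 2 / t))).mul_left (1 / (2 * t))
    rw [← Real.exp_eq_exp_ℝ] at h
    have e2 : (fun k : ℕ => ∫ ρ in Ioi (0 : ℝ), (-1) ^ k * μ ^ (2 * k) / (k.factorial : ℝ) ^ 2 *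
      (ρ ^ (2 * k + 1) * Real.exp (-(t * ρ ^ 2)))) =
      fun k : ℕ => 1 / (2 * t) * ((-(μ ^ 2 / t)) ^ k / k.factorial) := by
      ext k
      rw [integral_const_mul, (gauss_moment t ht k).2]
      have h1 : (k.factorial : ℝ) ≠ 0 := by exact_mod_cast k.factorial_ne_zero
      rw [neg_pow (μ ^ 2 / t), div_pow, ← pow_mul]
      field_simp
      try ring
    rw [e2]
    exact h
  · simp only [hnorm]
    exact (Real.summable_pow_div_factorial _).mul_left _

open MeasureTheory Set Filter Topology in
lemma weight_integrable (μ a : ℝ) (hμ : 0 < μ) (ha : 0 < a) :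
    IntegrableOn (fun ρ : ℝ => |besselJ0 (2 * μ * ρ)| * ρ / (a ^ 2 + ρ ^ 2)) (Ioi 0) := by
  have hcont : Continuous (fun ρ : ℝ => |besselJ0 (2 * μ * ρ)| * ρ / (a ^ 2 + ρ ^ 2)) := by
    refine Continuous.div ?_ (by fun_prop) (fun ρ => by positivity)
    have := besselJ0_continuous
    fun_prop
  obtain ⟨C, hC, hJ⟩ := besselJ0_decay
  set T := 1 / (2 * μ) with hT
  have hT0 : 0 < T := by positivity
  rw [← Ioc_union_Ioi_eq_Ioi hT0.le]
  refine IntegrableOn.union (hcont.integrableOn_Ioc) ?_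
  have hb := (integrableOn_Ioi_rpow_of_lt (show (-(3 / 2) : ℝ) < -1 by norm_num) hT0).const_mul
    (C * (2 * μ) ^ (-(1 / 2) : ℝ))
  refine Integrable.mono' hb hcont.aestronglyMeasurable ?_
  refine (ae_restrict_iff' measurableSet_Ioi).2 (Eventually.of_forall fun ρ hρ => ?_)
  have h1 : T < ρ := hρ
  have h0 : 0 < ρ := hT0.trans h1
  have h2 : 1 ≤ 2 * μ * ρ := by
    rw [hT, div_lt_iff₀ (by positivity)] at h1
    linarith
  rw [Real.norm_eq_abs, abs_of_nonneg (by positivity)]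
  calc |besselJ0 (2 * μ * ρ)| * ρ / (a ^ 2 + ρ ^ 2)
      ≤ (C * (2 * μ * ρ) ^ (-(1 / 2) : ℝ)) * ρ / (ρ ^ 2) := by
        gcongr
        · exact hJ _ h2
        · nlinarith
    _ = _ := by
      rw [Real.mul_rpow (by positivity) h0.le,
        show (-(3 / 2) : ℝ) = -(1 / 2) + (-1) by norm_num, Real.rpow_add h0, Real.rpow_neg_one]
      field_simp

open MeasureTheory Set Filter Topology in
lemma swap_step (μ a ν : ℝ) (hμ : 0 < μ) (ha : 0 < a) :
    ∫ ρ in Ioi (0 : ℝ), ∫ t in Ioi (0 : ℝ), (besselJ0 (2 * μ * ρ) : ℂ) * (ρ : ℂ) *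
      ((t : ℂ) ^ ((1 + Complex.I * ν) - 1) * Complex.exp (-(((a ^ 2 + ρ ^ 2 : ℝ) : ℂ) * t))) =
    ∫ t in Ioi (0 : ℝ), ∫ ρ in Ioi (0 : ℝ), (besselJ0 (2 * μ * ρ) : ℂ) * (ρ : ℂ) *
      ((t : ℂ) ^ ((1 + Complex.I * ν) - 1) * Complex.exp (-(((a ^ 2 + ρ ^ 2 : ℝ) : ℂ) * t))) := by
  apply integral_integral_swap
  have hJ := besselJ0_continuous.measurable
  rw [integrable_prod_iff]
  · have hpow : ∀ A : ℝ, 0 < A → ∀ t ∈ Ioi (0 : ℝ),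
      ‖(t : ℂ) ^ ((1 + Complex.I * ν) - 1) * Complex.exp (-((A : ℂ) * t))‖ = Real.exp (-A * t) := by
      intro A hA t ht
      rw [inc_norm _ _ _ ht]
      simp
    have hexp : ∀ A : ℝ, 0 < A → IntegrableOn (fun t => Real.exp (-A * t)) (Ioi 0) :=
      fun A hA => exp_neg_integrableOn_Ioi 0 hA
    constructor
    · refine (ae_restrict_iff' measurableSet_Ioi).2 (Eventually.of_forall fun ρ hρ => ?_)
      simp only [Function.uncurry_apply_pair]
      apply Integrable.const_mul
      refine Integrable.mono' (hexp (a ^ 2 + ρ ^ 2) (by positivity)) ?_ ?_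
      · apply Measurable.aestronglyMeasurable
        fun_prop
      · refine (ae_restrict_iff' measurableSet_Ioi).2 (Eventually.of_forall fun t ht => ?_)
        exact (hpow _ (by positivity) t ht).le
    · refine (integrableOn_congr_fun ?_ measurableSet_Ioi).2 (weight_integrable μ a hμ ha)
      intro ρ hρ
      have h0 : (0 : ℝ) < ρ := hρ
      simp only [Function.uncurry_apply_pair, norm_mul (_ * _) (_ * _)]
      rw [integral_const_mul, setIntegral_congr_fun measurableSet_Ioi
        (hpow (a ^ 2 + ρ ^ 2) (by positivity)), integral_exp_mul_Ioi (by
          have : 0 < a ^ 2 + ρ ^ 2 := by positivity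
          linarith)]
      rw [norm_mul, Complex.norm_real, Complex.norm_real, Real.norm_eq_abs, Real.norm_eq_abs,
        abs_of_pos h0]
      rw [mul_zero, Real.exp_zero, neg_div_neg_eq, mul_one_div]
  · apply Measurable.aestronglyMeasurable
    unfold Function.uncurry
    fun_prop

/-- For `ν ∈ ℝ∖{0}`, `μ > 0`, `H > 0` the integral
`∫_0^∞ J₀(2μρ) ρ (H⁻² + ρ²)^{−1−iν} dρ` converges absolutely and
`Γ(1+iν) ∫_0^∞ J₀(2μρ) ρ (H⁻²+ρ²)^{−1−iν} dρ = μ^{iν} H^{iν} K_{iν}(2μH⁻¹)`,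
i.e. the Whittaker matrix element `H⁻¹K_{iν}(2μH⁻¹)` equals
`μ^{−iν}Γ(1+iν)H^{−iν−1}` times that integral. -/
theorem whittaker_integral_representation (ν μ H : ℝ) (hν : ν ≠ 0)
    (hμ : 0 < μ) (hH : 0 < H) :
    MeasureTheory.IntegrableOn
      (fun ρ : ℝ => (besselJ0 (2 * μ * ρ) : ℂ) * (ρ : ℂ) *
        Complex.exp ((-1 - Complex.I * ν) * (Real.log (1 / H ^ 2 + ρ ^ 2) : ℂ)))
      (Set.Ioi 0) ∧
    Complex.Gamma (1 + Complex.I * ν) *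
      ∫ ρ in Set.Ioi (0 : ℝ), (besselJ0 (2 * μ * ρ) : ℂ) * (ρ : ℂ) *
        Complex.exp ((-1 - Complex.I * ν) * (Real.log (1 / H ^ 2 + ρ ^ 2) : ℂ))
    = Complex.exp (Complex.I * ν * (Real.log μ : ℂ))
        * Complex.exp (Complex.I * ν * (Real.log H : ℂ))
        * besselK (Complex.I * ν) (2 * μ / H) := by
  set a : ℝ := 1 / H with hadef
  have ha : 0 < a := by positivity
  have hA : ∀ ρ : ℝ, 1 / H ^ 2 + ρ ^ 2 = a ^ 2 + ρ ^ 2 := by intro ρ; rw [hadef]; ring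
  simp only [hA]
  constructor
  · refine MeasureTheory.Integrable.mono' (weight_integrable μ a hμ ha) ?_ ?_
    · apply Measurable.aestronglyMeasurable
      have hJ := besselJ0_continuous.measurable
      fun_prop
    · refine (MeasureTheory.ae_restrict_iff' measurableSet_Ioi).2
        (Filter.Eventually.of_forall fun ρ hρ => ?_)
      have h0 : (0 : ℝ) < ρ := hρ
      have hp : 0 < a ^ 2 + ρ ^ 2 := by positivity
      rw [norm_mul, norm_mul, Complex.norm_real, Complex.norm_real, Real.norm_eq_abs,
        Real.norm_eq_abs, abs_of_pos h0, Complex.norm_exp]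
      simp only [Complex.ofReal_re, Complex.sub_re, Complex.neg_re, Complex.one_re,
        Complex.I_re, Complex.I_im, Complex.ofReal_im, Complex.mul_re, zero_mul, mul_zero, sub_zero,
        neg_mul, one_mul]
      rw [Real.exp_neg, Real.exp_log hp, div_eq_mul_inv]
  · rw [← MeasureTheory.integral_const_mul]
    have e1 : ∀ ρ ∈ Set.Ioi (0 : ℝ), Complex.Gamma (1 + Complex.I * ν) *
        ((besselJ0 (2 * μ * ρ) : ℂ) * (ρ : ℂ) *
        Complex.exp ((-1 - Complex.I * ν) * (Real.log (a ^ 2 + ρ ^ 2) : ℂ))) =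
        ∫ t in Set.Ioi (0 : ℝ), (besselJ0 (2 * μ * ρ) : ℂ) * (ρ : ℂ) *
      ((t : ℂ) ^ ((1 + Complex.I * ν) - 1) * Complex.exp (-(((a ^ 2 + ρ ^ 2 : ℝ) : ℂ) * t))) := by
      intro ρ hρ
      have hp : 0 < a ^ 2 + ρ ^ 2 := by positivity
      rw [MeasureTheory.integral_const_mul,
        Complex.integral_cpow_mul_exp_neg_mul_Ioi (by simp) hp]
      have : (1 / ((a ^ 2 + ρ ^ 2 : ℝ) : ℂ)) ^ (1 + Complex.I * ν) =
        Complex.exp ((-1 - Complex.I * ν) * (Real.log (a ^ 2 + ρ ^ 2) : ℂ)) := by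
        rw [one_div, Complex.inv_cpow, Complex.cpow_def_of_ne_zero, ← Complex.exp_neg,
          ← Complex.ofReal_log hp.le]
        · congr 1; ring
        · exact_mod_cast hp.ne'
        · rw [Complex.arg_ofReal_of_nonneg hp.le]
          exact Real.pi_pos.ne
      rw [this]; ring
    rw [MeasureTheory.setIntegral_congr_fun measurableSet_Ioi e1, swap_step μ a ν hμ ha]
    have e2 : ∀ t ∈ Set.Ioi (0 : ℝ), (∫ ρ in Set.Ioi (0 : ℝ), (besselJ0 (2 * μ * ρ) : ℂ) * (ρ : ℂ) *
      ((t : ℂ) ^ ((1 + Complex.I * ν) - 1) * Complex.exp (-(((a ^ 2 + ρ ^ 2 : ℝ) : ℂ) * t)))) =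
      1 / 2 * ((t : ℂ) ^ (Complex.I * ν - 1) * Complex.exp (-(((a ^ 2 : ℝ) : ℂ) * t)) *
      Complex.exp (-(((μ ^ 2 : ℝ) : ℂ) / t))) := by
      intro t ht
      have h0 : (0 : ℝ) < t := ht
      have htc : (t : ℂ) ≠ 0 := by exact_mod_cast h0.ne'
      have e3 : ∀ ρ : ℝ, (besselJ0 (2 * μ * ρ) : ℂ) * (ρ : ℂ) *
        ((t : ℂ) ^ ((1 + Complex.I * ν) - 1) * Complex.exp (-(((a ^ 2 + ρ ^ 2 : ℝ) : ℂ) * t))) =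
        ((t : ℂ) ^ (Complex.I * ν) * Complex.exp (-(((a ^ 2 : ℝ) : ℂ) * t))) *
          ((besselJ0 (2 * μ * ρ) * ρ * Real.exp (-(t * ρ ^ 2)) : ℝ) : ℂ) := by
        intro ρ
        rw [show -(((a ^ 2 + ρ ^ 2 : ℝ) : ℂ) * t) = -(((a ^ 2 : ℝ) : ℂ) * t) + -(t * (ρ : ℂ) ^ 2) by
          push_cast; ring, Complex.exp_add, add_sub_cancel_left]
        push_cast
        ring
      simp only [e3]
      rw [MeasureTheory.integral_const_mul, integral_complex_ofReal, gauss_bessel t μ h0 hμ,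
        Complex.cpow_sub _ _ htc, Complex.cpow_one]
      push_cast
      field_simp
    rw [MeasureTheory.setIntegral_congr_fun measurableSet_Ioi e2, MeasureTheory.integral_const_mul,
      macdonald (Complex.I * ν) (by simpa using hν) a μ ha hμ]
    have e4 : ((μ / a : ℝ) : ℂ) ^ (Complex.I * ν) = Complex.exp (Complex.I * ν * (Real.log μ : ℂ))
        * Complex.exp (Complex.I * ν * (Real.log H : ℂ)) := by
      have h1 : μ / a = μ * H := by rw [hadef]; field_simp
      have h2 : ((μ * H : ℝ) : ℂ) ≠ 0 := by
        have : μ * H ≠ 0 := by positivity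
        exact_mod_cast this
      rw [h1, Complex.cpow_def_of_ne_zero h2, ← Complex.ofReal_log (by positivity),
        Real.log_mul hμ.ne' hH.ne', ← Complex.exp_add]
      congr 1
      push_cast
      ring
    have e5 : (2 * ((μ * a : ℝ) : ℂ)) = 2 * μ / H := by
      rw [hadef]; push_cast; ring
    rw [e4, e5]
    ring
end

section
/- Let 0 < q < 1, ν ∈ ℝ, n ∈ ℤ and set ρ = iν + n. Define operators on functions f : ℂ∖{0} → ℂ by (Af)(z) = q^{(ρ−1)/2} f(q^{−1}z), (Df)(z) = q^{−(ρ−1)/2} f(qz), (Bf)(z) = q^{ρ/2} (f(q^{−1}z) − f(qz)) / ((1−q²) z), (Cf)(z) = (z/(1−q²)) (−q^{(ρ+2)/2} f(q^{−1}z) + q^{−3ρ/2+3} f(qz)). Then these operators satisfy the defining relations of U_q(sl₂): A∘D = D∘A = Id, A∘B = q·B∘A, B∘D = q·D∘B, A∘C = q^{−1}·C∘A, C∘D = q^{−1}·D∘C, and B∘C − C∘B = (A∘A − D∘D)/(q − q^{−1}), as identities of operators on functions on ℂ∖{0}. -/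
/-- `q^w = exp(w ln q)` for real `q > 0` and complex `w`. -/
noncomputable def qpow (q : ℝ) (w : ℂ) : ℂ := Complex.exp (w * (Real.log q : ℂ))

/-- `(Af)(z) = q^{(ρ−1)/2} f(q⁻¹ z)`. -/
noncomputable def opA (q : ℝ) (ρ : ℂ) (f : ℂ → ℂ) : ℂ → ℂ :=
  fun z => qpow q ((ρ - 1) / 2) * f ((q : ℂ)⁻¹ * z)

/-- `(Df)(z) = q^{−(ρ−1)/2} f(q z)`. -/
noncomputable def opD (q : ℝ) (ρ : ℂ) (f : ℂ → ℂ) : ℂ → ℂ :=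
  fun z => qpow q (-((ρ - 1) / 2)) * f ((q : ℂ) * z)

/-- `(Bf)(z) = q^{ρ/2}(f(q⁻¹z) − f(qz))/((1−q²)z)`. -/
noncomputable def opB (q : ℝ) (ρ : ℂ) (f : ℂ → ℂ) : ℂ → ℂ :=
  fun z => qpow q (ρ / 2) * (f ((q : ℂ)⁻¹ * z) - f ((q : ℂ) * z)) / ((1 - (q : ℂ) ^ 2) * z)

/-- `(Cf)(z) = (z/(1−q²))(−q^{(ρ+2)/2} f(q⁻¹z) + q^{−3ρ/2+3} f(qz))`. -/
noncomputable def opC (q : ℝ) (ρ : ℂ) (f : ℂ → ℂ) : ℂ → ℂ :=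
  fun z => z / (1 - (q : ℂ) ^ 2) *
    (-(qpow q ((ρ + 2) / 2)) * f ((q : ℂ)⁻¹ * z) + qpow q (-(3 * ρ / 2) + 3) * f ((q : ℂ) * z))

/-- `q^(v+w) = q^v q^w`. -/
theorem qpow_add (q : ℝ) (v w : ℂ) : qpow q (v + w) = qpow q v * qpow q w := by
  simp only [qpow, add_mul, Complex.exp_add]

theorem qpow_one_eq (q : ℝ) (hq : 0 < q) : qpow q 1 = q := by
  rw [qpow, one_mul, ← Complex.ofReal_exp, Real.exp_log hq]

/-- The principal series operators of the quantum Lorentz group satisfy the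
defining relations of `U_q(sl₂)` as operators on functions on `ℂ∖{0}`. -/
theorem principal_series_Uq_relations (q : ℝ) (hq0 : 0 < q) (hq1 : q < 1)
    (ν : ℝ) (n : ℤ) (ρ : ℂ) (hρ : ρ = Complex.I * ν + n)
    (f : ℂ → ℂ) (z : ℂ) (hz : z ≠ 0) :
    opA q ρ (opD q ρ f) z = f z ∧
    opD q ρ (opA q ρ f) z = f z ∧
    opA q ρ (opB q ρ f) z = (q : ℂ) * opB q ρ (opA q ρ f) z ∧
    opB q ρ (opD q ρ f) z = (q : ℂ) * opD q ρ (opB q ρ f) z ∧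
    opA q ρ (opC q ρ f) z = (q : ℂ)⁻¹ * opC q ρ (opA q ρ f) z ∧
    opC q ρ (opD q ρ f) z = (q : ℂ)⁻¹ * opD q ρ (opC q ρ f) z ∧
    opB q ρ (opC q ρ f) z - opC q ρ (opB q ρ f) z
      = (opA q ρ (opA q ρ f) z - opD q ρ (opD q ρ f) z) / ((q : ℂ) - (q : ℂ)⁻¹) := by
  have hq : (q : ℂ) ≠ 0 := by exact_mod_cast (ne_of_gt hq0)
  have hq2 : 1 - (q : ℂ) ^ 2 ≠ 0 := by
    have : 1 - q ^ 2 ≠ 0 := by nlinarith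
    exact_mod_cast this
  have hqq : (q : ℂ) - (q : ℂ)⁻¹ = -(1 - (q : ℂ) ^ 2) / q := by field_simp; ring
  have h1 := qpow_one_eq q hq0
  have had : qpow q ((ρ - 1) / 2) * qpow q (-((ρ - 1) / 2)) = 1 := by
    rw [← qpow_add]; simp [qpow]
  have hbc : qpow q (ρ / 2) * qpow q ((ρ + 2) / 2)
      = qpow q ((ρ - 1) / 2) * qpow q ((ρ - 1) / 2) * (q : ℂ) ^ 2 := by
    rw [← h1, pow_two, ← qpow_add, ← qpow_add, ← qpow_add, ← qpow_add]
    congr 1; ring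
  have hbd : qpow q (ρ / 2) * qpow q (-(3 * ρ / 2) + 3)
      = qpow q (-((ρ - 1) / 2)) * qpow q (-((ρ - 1) / 2)) * (q : ℂ) ^ 2 := by
    rw [← h1, pow_two, ← qpow_add, ← qpow_add, ← qpow_add, ← qpow_add]
    congr 1; ring
  have e1 : (q : ℂ)⁻¹ * ((q : ℂ) * z) = z := by field_simp
  have e2 : (q : ℂ) * ((q : ℂ)⁻¹ * z) = z := by field_simp
  simp only [opA, opB, opC, opD, e1, e2, hqq]
  generalize qpow q ((ρ - 1) / 2) = a at *
  generalize qpow q (-((ρ - 1) / 2)) = e at *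
  generalize qpow q (ρ / 2) = b at *
  generalize qpow q ((ρ + 2) / 2) = c at *
  generalize qpow q (-(3 * ρ / 2) + 3) = d at *
  generalize f ((q : ℂ)⁻¹ * ((q : ℂ)⁻¹ * z)) = u
  generalize f ((q : ℂ) * ((q : ℂ) * z)) = v
  generalize f z = w
  generalize (q : ℂ) = t at *
  refine ⟨?_, ?_, ?_, ?_, ?_, ?_, ?_⟩
  · linear_combination w * had
  · linear_combination w * had
  · field_simp
  · field_simp
  · field_simp
  · field_simp
  · have key : b * ((t⁻¹ * z) / (1 - t ^ 2) * (-c * u + d * w)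
          - t * z / (1 - t ^ 2) * (-c * w + d * v)) / ((1 - t ^ 2) * z)
        - z / (1 - t ^ 2) * (-c * (b * (u - w) / ((1 - t ^ 2) * (t⁻¹ * z)))
          + d * (b * (w - v) / ((1 - t ^ 2) * (t * z))))
        = -((b * c) * u - (b * d) * v) / (t * (1 - t ^ 2)) := by
      field_simp
      ring
    rw [key, hbc, hbd]
    field_simp
end
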